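/- Let 2 ≤ t ≤ r be integers and let G be a K_{r+1}-free graph. Then (|C_t(G)|/C(r,t))^{1/t} ≤ (|C_2(G)|/C(r,2))^{1/2}, i.e., |C_t(G)| ≤ C(r,t)·(|C_2(G)|/C(r,2))^{t/2}. (Special case s = 2 of the Bollobás–Sós clique-ratio inequality needed in the stability proof.) -/

import Mathlib

open SimpleGraph Finset Real

open Polynomial in
/-- The derivative of a monic real-rooted polynomial with nonpositive roots is of the same kind. -/
theorem exists_derivative_prod_X_add_C (s : Multiset ℝ) (hs : ∀ x ∈ s, 0 ≤ x) {r : ℕ}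
    (hr : Multiset.card s = r + 1) :
    ∃ y : Multiset ℝ, (∀ x ∈ y, 0 ≤ x) ∧ Multiset.card y = r ∧
      derivative (s.map fun a => X + C a).prod =
        C ((r : ℝ) + 1) * (y.map fun a => X + C a).prod := by
  set p : ℝ[X] := (s.map fun a => X + C a).prod with hp
  have hmonic : p.Monic := monic_multiset_prod_of_monic _ _ fun a _ => monic_X_add_C a
  have hdeg : p.natDegree = r + 1 := by
    rw [hp, natDegree_multiset_prod_of_monic]
    · simp [hr, add_comm]
    · intro f hf
      obtain ⟨a, -, rfl⟩ := Multiset.mem_map.1 hf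
      exact monic_X_add_C a
  have hsplit : p.Splits := by
    refine Splits.multisetProd fun f hf => ?_
    obtain ⟨a, -, rfl⟩ := Multiset.mem_map.1 hf
    exact Splits.X_add_C a
  have hnonneg (k : ℕ) : 0 ≤ p.coeff k := by
    rcases le_or_gt k (Multiset.card s) with hk | hk
    · rw [hp, Multiset.prod_X_add_C_coeff _ hk, Multiset.esymm]
      refine Multiset.sum_nonneg fun z hz => ?_
      obtain ⟨u, hu, rfl⟩ := Multiset.mem_map.1 hz
      exact Multiset.prod_nonneg fun x hx =>
        hs x (Multiset.mem_of_le (Multiset.mem_powersetCard.1 hu).1 hx)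
    · rw [coeff_eq_zero_of_natDegree_lt (by omega)]
  have hdeg' : (derivative p).natDegree = r := by
    rw [natDegree_derivative, hdeg, Nat.add_sub_cancel]
  have hlead : (derivative p).leadingCoeff = r + 1 := by
    have h := hmonic.coeff_natDegree
    rw [hdeg] at h
    rw [leadingCoeff, hdeg', coeff_derivative, h, one_mul]
  have hne : derivative p ≠ 0 := by
    intro h
    rw [h, leadingCoeff_zero] at hlead
    exact (by positivity : (0 : ℝ) < r + 1).ne hlead
  have hcard : Multiset.card (derivative p).roots = r := by
    have h1 := card_roots_le_derivative p
    have h2 := card_roots' (derivative p)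
    have h3 := splits_iff_card_roots.1 hsplit
    omega
  have hsplit' : (derivative p).Splits := splits_iff_card_roots.2 (by rw [hcard, hdeg'])
  refine ⟨(derivative p).roots.map Neg.neg, fun x hx => ?_, by simpa using hcard, ?_⟩
  · obtain ⟨y, hy, rfl⟩ := Multiset.mem_map.1 hx
    by_contra! hlt
    have hy0 : 0 < y := by simpa using hlt
    have hroot : (derivative p).eval y = 0 := (mem_roots hne).1 hy
    rw [eval_eq_sum_range, hdeg'] at hroot
    have hc (i : ℕ) : 0 ≤ (derivative p).coeff i := by
      rw [coeff_derivative]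
      exact mul_nonneg (hnonneg _) (by positivity)
    have h := (sum_eq_zero_iff_of_nonneg
      fun i _ => mul_nonneg (hc i) (pow_nonneg hy0.le i)).1 hroot r (by simp)
    have hr' : (derivative p).coeff r = r + 1 := by rw [← hlead, leadingCoeff, hdeg']
    rw [hr'] at h
    have : (0 : ℝ) < (r + 1) * y ^ r := by positivity
    exact this.ne' h
  · conv_lhs => rw [hsplit'.eq_prod_roots, hlead]
    simp [Multiset.map_map, sub_eq_add_neg]

/-- Every normalized elementary symmetric mean of order at most `r` of `r + 1` nonnegative numbers
is that of suitable `r` nonnegative numbers. -/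
theorem exists_esymm_div_choose_eq (s : Multiset ℝ) (hs : ∀ x ∈ s, 0 ≤ x) {r : ℕ}
    (hr : Multiset.card s = r + 1) :
    ∃ y : Multiset ℝ, (∀ x ∈ y, 0 ≤ x) ∧ Multiset.card y = r ∧
      ∀ j ≤ r, s.esymm j / (r + 1).choose j = y.esymm j / r.choose j := by
  obtain ⟨y, hy, hcard, h⟩ := exists_derivative_prod_X_add_C s hs hr
  refine ⟨y, hy, hcard, fun j hj => ?_⟩
  have hcoeff := congrArg (fun q : Polynomial ℝ => q.coeff (r - j)) h
  simp only [Polynomial.coeff_derivative, Polynomial.coeff_C_mul] at hcoeff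
  rw [Multiset.prod_X_add_C_coeff _ (by omega), Multiset.prod_X_add_C_coeff _ (by omega), hr,
    hcard, show r + 1 - (r - j + 1) = j by omega, show r - (r - j) = j by omega] at hcoeff
  have hchoose : ((r.choose j : ℕ) : ℝ) * (r + 1) = (r + 1).choose j * ((r - j : ℕ) + 1) := by
    have := Nat.choose_mul_succ_eq r j
    rw [show r + 1 - j = r - j + 1 by omega] at this
    exact_mod_cast this
  have h1 : (0 : ℝ) < r.choose j := by exact_mod_cast Nat.choose_pos hj
  have h2 : (0 : ℝ) < (r + 1).choose j := by exact_mod_cast Nat.choose_pos (by omega)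
  rw [div_eq_div_iff h2.ne' h1.ne']
  have h3 : (0 : ℝ) < (r : ℝ) + 1 := by positivity
  apply mul_right_cancel₀ h3.ne'
  linear_combination s.esymm j * hchoose + ((r + 1).choose j : ℝ) * hcoeff

theorem sq_prod_le_pow_sum_pairs {t : ℕ} (ht : 2 ≤ t) (x : Fin t → ℝ) (hx : ∀ i, 0 ≤ x i) :
    (∏ i, x i) ^ 2 ≤
      ((∑ T ∈ (univ : Finset (Fin t)).powersetCard 2, ∏ i ∈ T, x i) / t.choose 2) ^ t := by
  set P := (univ : Finset (Fin t)).powersetCard 2 with hP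
  have hcardP : #P = t.choose 2 := by simp [hP]
  have hpos : (0 : ℝ) < t.choose 2 := by exact_mod_cast Nat.choose_pos ht
  have hprod0 (T : Finset (Fin t)) : 0 ≤ ∏ i ∈ T, x i := prod_nonneg fun i _ => hx i
  set M := (∑ T ∈ P, ∏ i ∈ T, x i) / t.choose 2 with hM
  have hM0 : 0 ≤ M := div_nonneg (sum_nonneg fun T _ => hprod0 T) hpos.le
  have hpairs : ∏ T ∈ P, ∏ i ∈ T, x i = (∏ i, x i) ^ (t - 1) := by
    rw [prod_comm' (t' := univ) (s' := fun i => {T ∈ P | {i} ⊆ T}) (by simp), ← prod_pow]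
    refine prod_congr rfl fun i _ => ?_
    rw [prod_const, hP, card_filter_powersetCard_subset _ _ _ (by simp) (by simp)]
    simp
  have hamgm := geom_mean_le_arith_mean P (fun _ => 1) (fun T => ∏ i ∈ T, x i)
    (by simp) (by simp [hcardP, hpos]) (fun T _ => hprod0 T)
  simp only [rpow_one, one_mul, sum_const, hcardP, nsmul_eq_mul, mul_one] at hamgm
  rw [← hM, hpairs, rpow_inv_le_iff_of_pos (pow_nonneg (hprod0 _) _) hM0 hpos, rpow_natCast]
    at hamgm
  refine le_of_pow_le_pow_left₀ (n := t - 1) (by omega) (pow_nonneg hM0 _) ?_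
  calc ((∏ i, x i) ^ 2) ^ (t - 1) = ((∏ i, x i) ^ (t - 1)) ^ 2 := by ring
    _ ≤ (M ^ t.choose 2) ^ 2 := pow_le_pow_left₀ (pow_nonneg (hprod0 _) _) hamgm 2
    _ = (M ^ t) ^ (t - 1) := by
      rw [← pow_mul, ← pow_mul, Nat.choose_two_right,
        Nat.div_mul_cancel (Nat.even_mul_pred_self t).two_dvd]

/-- **Maclaurin's inequality** between the elementary symmetric means of orders `2` and `t`. -/
theorem sq_esymm_div_choose_le {t r : ℕ} (ht : 2 ≤ t) (htr : t ≤ r) (s : Multiset ℝ)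
    (hs : ∀ x ∈ s, 0 ≤ x) (hr : Multiset.card s = r) :
    (s.esymm t / r.choose t) ^ 2 ≤ (s.esymm 2 / r.choose 2) ^ t := by
  induction r, htr using Nat.le_induction generalizing s with
  | base =>
    obtain ⟨l, rfl⟩ := Quot.exists_rep s
    obtain rfl : l.length = t := hr
    have hl : Multiset.map l.get univ.val = (l : Multiset ℝ) := by
      simp [Fin.univ_val_map]
    have h := sq_prod_le_pow_sum_pairs ht l.get fun i => hs _ (List.get_mem l i)
    have hesymm (j : ℕ) := Finset.esymm_map_val l.get univ j
    rw [hl] at hesymm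
    change (((l : Multiset ℝ)).esymm _ / _) ^ 2 ≤ (((l : Multiset ℝ)).esymm _ / _) ^ _
    rw [hesymm, hesymm]
    convert h using 2
    have : (univ : Finset (Fin l.length)).powersetCard l.length = {univ} := by
      simpa using powersetCard_self (univ : Finset (Fin l.length))
    simp [this]
  | succ r hle ih =>
    obtain ⟨y, hy, hcard, h⟩ := exists_esymm_div_choose_eq s hs hr
    rw [h t hle, h 2 (by omega)]
    exact ih y hy hcard

theorem esymm_add_replicate_zero (s : Multiset ℝ) (m j : ℕ) :
    (s + Multiset.replicate m 0).esymm j = s.esymm j := by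
  induction m with
  | zero => simp
  | succ m ih =>
    rw [Multiset.replicate_succ, Multiset.add_cons, ← ih]
    cases j with
    | zero => simp [Multiset.esymm]
    | succ j => simp [Multiset.esymm]

/-- Maclaurin's inequality with the family padded by zeros to `r` members. -/
theorem sq_esymm_div_choose_le_of_card_le {t r : ℕ} (ht : 2 ≤ t) (htr : t ≤ r) (s : Multiset ℝ)
    (hs : ∀ x ∈ s, 0 ≤ x) (hr : Multiset.card s ≤ r) :
    (s.esymm t / r.choose t) ^ 2 ≤ (s.esymm 2 / r.choose 2) ^ t := by
  have h := sq_esymm_div_choose_le ht htr (s + Multiset.replicate (r - Multiset.card s) 0) ?_ ?_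
  · simpa only [esymm_add_replicate_zero] using h
  · intro x hx
    rcases Multiset.mem_add.1 hx with hx | hx
    · exact hs x hx
    · exact (Multiset.eq_of_mem_replicate hx).ge
  · rw [Multiset.card_add, Multiset.card_replicate]
    omega

/-- The sum over the `t`-cliques of `G` of the products of the vertex weights `x`. -/
noncomputable def cliqueWeight {V : Type*} [Fintype V] [DecidableEq V] (G : SimpleGraph V)
    [DecidableRel G.Adj] (t : ℕ) (x : V → ℝ) : ℝ :=
  ∑ T ∈ G.cliqueFinset t, ∏ w ∈ T, x w

/-- The sum over the `t`-cliques of `G` containing `u` of the products of the weights `x` of the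
vertices other than `u`. -/
noncomputable def linkWeight {V : Type*} [Fintype V] [DecidableEq V] (G : SimpleGraph V)
    [DecidableRel G.Adj] (t : ℕ) (x : V → ℝ) (u : V) : ℝ :=
  ∑ T ∈ G.cliqueFinset t with u ∈ T, ∏ w ∈ T.erase u, x w

section

variable {V : Type*} [Fintype V] [DecidableEq V] (G : SimpleGraph V) [DecidableRel G.Adj]

theorem linkWeight_nonneg (t : ℕ) {x : V → ℝ} (hx : ∀ w, 0 ≤ x w) (u : V) :
    0 ≤ linkWeight G t x u :=
  sum_nonneg fun _ _ => prod_nonneg fun w _ => hx w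

theorem linkWeight_eq_zero {t : ℕ} (ht : 2 ≤ t) {x : V → ℝ} (hx : ∀ w, 0 ≤ x w) {u : V}
    (h : linkWeight G 2 x u = 0) : linkWeight G t x u = 0 := by
  refine sum_eq_zero fun T hT => ?_
  obtain ⟨hT, hu⟩ := mem_filter.1 hT
  rw [mem_cliqueFinset_iff, isNClique_iff] at hT
  obtain ⟨w, hw, hwu⟩ := exists_mem_ne (show 1 < #T by omega) u
  refine prod_eq_zero (mem_erase.2 ⟨hwu, hw⟩) ?_
  have hmem : ({u, w} : Finset V) ∈ {T ∈ G.cliqueFinset 2 | u ∈ T} := by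
    rw [mem_filter, mem_cliqueFinset_iff, isNClique_iff]
    refine ⟨⟨?_, card_pair hwu.symm⟩, by simp⟩
    rw [coe_pair, isClique_pair]
    exact fun hne => hT.1 hu hw hne
  have h0 := (sum_eq_zero_iff_of_nonneg fun _ _ => prod_nonneg fun w _ => hx w).1 h _ hmem
  rwa [erase_insert (by simpa using hwu.symm), prod_singleton] at h0

/-- The clique weight is affine in the weights of two nonadjacent vertices. -/
theorem cliqueWeight_update_update {u v : V} (huv : u ≠ v) (hadj : ¬ G.Adj u v) (t : ℕ)
    (x : V → ℝ) (a b : ℝ) :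
    cliqueWeight G t (Function.update (Function.update x u a) v b) =
      (∑ T ∈ G.cliqueFinset t with u ∉ T ∧ v ∉ T, ∏ w ∈ T, x w) +
        linkWeight G t x u * a + linkWeight G t x v * b := by
  rw [cliqueWeight, linkWeight, linkWeight, sum_filter, sum_filter, sum_filter, sum_mul, sum_mul,
    ← sum_add_distrib, ← sum_add_distrib]
  refine sum_congr rfl fun T hT => ?_
  rw [mem_cliqueFinset_iff, isNClique_iff] at hT
  by_cases hu : u ∈ T <;> by_cases hv : v ∈ T
  · exact absurd (hT.1 hu hv huv) hadj
  · rw [← mul_prod_erase T _ hu]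
    have : ∏ w ∈ T.erase u, Function.update (Function.update x u a) v b w =
        ∏ w ∈ T.erase u, x w := prod_congr rfl fun w hw => by
      rw [Function.update_of_ne, Function.update_of_ne]
      · exact ne_of_mem_erase hw
      · rintro rfl
        exact hv (mem_of_mem_erase hw)
    rw [this]
    simp [hu, hv, huv, mul_comm]
  · rw [← mul_prod_erase T _ hv]
    have : ∏ w ∈ T.erase v, Function.update (Function.update x u a) v b w =
        ∏ w ∈ T.erase v, x w := prod_congr rfl fun w hw => by
      rw [Function.update_of_ne, Function.update_of_ne]
      · rintro rfl
        exact hu (mem_of_mem_erase hw)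
      · exact ne_of_mem_erase hw
    rw [this]
    simp [hu, hv, mul_comm]
  · simp only [hu, hv, not_false_eq_true, and_self, if_true, if_false, zero_mul, add_zero]
    refine prod_congr rfl fun w hw => ?_
    rw [Function.update_of_ne, Function.update_of_ne]
    · rintro rfl
      exact hu hw
    · rintro rfl
      exact hv hw

/-- On a level line of `B * a + C * b` in the quadrant, `B' * a + C' * b` is maximal on the
boundary. -/
theorem exists_boundary_point {a b B C B' C' : ℝ} (ha : 0 ≤ a) (hb : 0 ≤ b) (hB : 0 ≤ B)
    (hC : 0 ≤ C) (hBB' : B = 0 → B' = 0) (hCC' : C = 0 → C' = 0) :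
    ∃ a' b' : ℝ, 0 ≤ a' ∧ 0 ≤ b' ∧ (a' = 0 ∨ b' = 0) ∧ B * a' + C * b' = B * a + C * b ∧
      B' * a + C' * b ≤ B' * a' + C' * b' := by
  rcases hB.eq_or_lt with hB0 | hB0
  · exact ⟨0, b, le_rfl, hb, .inl rfl, by simp [← hB0], by simp [hBB' hB0.symm]⟩
  rcases hC.eq_or_lt with hC0 | hC0
  · exact ⟨a, 0, ha, le_rfl, .inr rfl, by simp [← hC0], by simp [hCC' hC0.symm]⟩
  rcases le_total (B * C') (C * B') with h | h
  · refine ⟨a + C * b / B, 0, by positivity, le_rfl, .inr rfl, by field_simp; ring, ?_⟩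
    have : C' * b ≤ B' * (C * b / B) := by
      rw [mul_div_assoc', le_div_iff₀ hB0]
      nlinarith
    linarith
  · refine ⟨0, b + B * a / C, le_rfl, by positivity, .inl rfl, by field_simp; ring, ?_⟩
    have : B' * a ≤ C' * (B * a / C) := by
      rw [mul_div_assoc', le_div_iff₀ hC0]
      nlinarith
    linarith

/-- If the support of the weights is not a clique, it can be shrunk while keeping the edge weight
and not decreasing the `t`-clique weight. -/
theorem exists_support_ssubset {t : ℕ} (ht : 2 ≤ t) {x : V → ℝ} (hx : ∀ w, 0 ≤ x w)
    (hclique : ¬ G.IsClique {w | x w ≠ 0}) :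
    ∃ y : V → ℝ, (∀ w, 0 ≤ y w) ∧
      ({w | y w ≠ 0} : Finset V) ⊂ ({w | x w ≠ 0} : Finset V) ∧
      cliqueWeight G 2 y = cliqueWeight G 2 x ∧ cliqueWeight G t x ≤ cliqueWeight G t y := by
  simp only [isClique_iff, Set.Pairwise, not_forall] at hclique
  obtain ⟨u, hu, v, hv, huv, hadj⟩ := hclique
  obtain ⟨a, b, ha, hb, hab, heq, hle⟩ := exists_boundary_point (hx u) (hx v)
    (linkWeight_nonneg G 2 hx u) (linkWeight_nonneg G 2 hx v)
    (linkWeight_eq_zero G ht hx) (linkWeight_eq_zero G ht hx)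
  have hself : Function.update (Function.update x u (x u)) v (x v) = x := by simp
  have hxj (j : ℕ) := cliqueWeight_update_update G huv hadj j x (x u) (x v)
  rw [hself] at hxj
  refine ⟨Function.update (Function.update x u a) v b, fun w => ?_, ?_, ?_, ?_⟩
  · by_cases hwv : w = v
    · simpa [hwv] using hb
    by_cases hwu : w = u
    · simpa [hwu, huv] using ha
    simpa [hwu, hwv] using hx w
  · rw [ssubset_iff_of_subset]
    · rcases hab with rfl | rfl
      · exact ⟨u, by simpa using hu, by simp [huv]⟩
      · exact ⟨v, by simpa using hv, by simp⟩
    · intro w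
      by_cases hwv : w = v
      · subst hwv
        exact fun _ => by simpa using hv
      by_cases hwu : w = u
      · subst hwu
        exact fun _ => by simpa using hu
      simp [hwu, hwv]
  · rw [hxj, cliqueWeight_update_update G huv hadj]
    linarith
  · rw [hxj, cliqueWeight_update_update G huv hadj]
    linarith

theorem cliqueWeight_eq_esymm {x : V → ℝ} (hclique : G.IsClique {w | x w ≠ 0}) (j : ℕ) :
    cliqueWeight G j x = (({w | x w ≠ 0} : Finset V).val.map x).esymm j := by
  rw [Finset.esymm_map_val, cliqueWeight]
  symm
  refine sum_subset (fun T hT => ?_) fun T hT hT' => ?_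
  · obtain ⟨hsub, hcard⟩ := mem_powersetCard.1 hT
    rw [mem_cliqueFinset_iff, isNClique_iff]
    exact ⟨hclique.subset fun w hw => by simpa using hsub hw, hcard⟩
  · rw [mem_cliqueFinset_iff, isNClique_iff] at hT
    have hsub : ¬ T ⊆ ({w | x w ≠ 0} : Finset V) := fun h =>
      hT' (mem_powersetCard.2 ⟨h, hT.2⟩)
    obtain ⟨w, hw, hw0⟩ := not_subset.1 hsub
    exact prod_eq_zero hw (by simpa using hw0)

/-- The clique-ratio inequality for vertex-weighted graphs. -/
theorem sq_cliqueWeight_div_choose_le {t r : ℕ} (ht : 2 ≤ t) (htr : t ≤ r)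
    (hfree : G.CliqueFree (r + 1)) (x : V → ℝ) (hx : ∀ w, 0 ≤ x w) :
    (cliqueWeight G t x / r.choose t) ^ 2 ≤ (cliqueWeight G 2 x / r.choose 2) ^ t := by
  induction hS : ({w | x w ≠ 0} : Finset V) using Finset.strongInduction generalizing x with
  | H S ih =>
    by_cases hclique : G.IsClique {w | x w ≠ 0}
    · rw [cliqueWeight_eq_esymm G hclique, cliqueWeight_eq_esymm G hclique]
      refine sq_esymm_div_choose_le_of_card_le ht htr _ ?_ ?_
      · intro z hz
        obtain ⟨w, -, rfl⟩ := Multiset.mem_map.1 hz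
        exact hx w
      · rw [Multiset.card_map, card_val]
        by_contra! hlt
        refine hfree.mono hlt _ (isNClique_iff _ |>.2 ⟨?_, rfl⟩)
        simpa using hclique
    · obtain ⟨y, hy, hsub, h2, hle⟩ := exists_support_ssubset G ht hx hclique
      rw [← h2]
      refine le_trans ?_ (ih _ (hS ▸ hsub) y hy rfl)
      have : 0 ≤ cliqueWeight G t x := sum_nonneg fun _ _ => prod_nonneg fun w _ => hx w
      gcongr

end

/-- Bollobás–Sós clique-ratio inequality (case s = 2): for a K_{r+1}-free graph,
(|C_t(G)|/C(r,t))^{1/t} ≤ (|C_2(G)|/C(r,2))^{1/2}. -/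
theorem stmt_11 (n r t : ℕ) (G : SimpleGraph (Fin n)) [DecidableRel G.Adj]
    (hfree : G.CliqueFree (r + 1)) (ht : 2 ≤ t) (htr : t ≤ r) :
    (((G.cliqueFinset t).card : ℝ) / (r.choose t : ℝ)) ^ ((1 : ℝ) / t) ≤
      (((G.cliqueFinset 2).card : ℝ) / (r.choose 2 : ℝ)) ^ ((1 : ℝ) / 2) := by
  have h := sq_cliqueWeight_div_choose_le G ht htr hfree (fun _ => 1) fun _ => zero_le_one
  simp only [cliqueWeight, prod_const_one, sum_const, nsmul_eq_mul, mul_one] at h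
  set p : ℝ := ((G.cliqueFinset t).card : ℝ) / (r.choose t : ℝ)
  set q : ℝ := ((G.cliqueFinset 2).card : ℝ) / (r.choose 2 : ℝ)
  have hp : 0 ≤ p := by positivity
  have hq : 0 ≤ q := by positivity
  have ht0 : (t : ℝ) ≠ 0 := by positivity
  calc p ^ ((1 : ℝ) / t) = (p ^ 2) ^ ((1 : ℝ) / (2 * t)) := by
        rw [← rpow_natCast, ← rpow_mul hp]
        congr 1
        push_cast
        field_simp
    _ ≤ (q ^ t) ^ ((1 : ℝ) / (2 * t)) := by gcongr
    _ = q ^ ((1 : ℝ) / 2) := by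
        rw [← rpow_natCast, ← rpow_mul hq]
        congr 1
        field_simp
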